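/- Let f : ℝ → ℝ be a nonlinearity of the form f(u) = u·f₀(u²) satisfying assumptions (A1)–(A5), let R > 0, and let ψ : ℝ³ → ℝ be a smooth compactly supported radial function (ψ(z) depends only on |z|). Let u : ℝ × ℝ³ → ℝ be a smooth global solution of the semilinear wave equation ∂ₜ²u − Δu + f(u) = 0 with initial data u(0,·) = 0 and ∂ₜu(0,·) = ψ. Suppose that for every s ≤ −R and every θ in the unit sphere 𝕊² of ℝ³, the quantity r·(∂ₜu)(s + r, rθ) tends to 0 as r → ∞. Then ψ(z) = 0 for every z with |z| ≥ R. -/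

import Mathlib

open MeasureTheory Filter Real Metric

noncomputable section

/-- Euclidean 3-space. -/
abbrev R3 : Type := EuclideanSpace ℝ (Fin 3)

/-- Time derivative ∂ₜu. -/
def dt (u : ℝ → R3 → ℝ) (t : ℝ) (z : R3) : ℝ := deriv (fun τ => u τ z) t

/-- Second time derivative ∂ₜ²u. -/
def dt2 (u : ℝ → R3 → ℝ) (t : ℝ) (z : R3) : ℝ := deriv (fun τ => dt u τ z) t

/-- Spatial Laplacian: the sum of the three second partial derivatives. -/
def lap (w : R3 → ℝ) (z : R3) : ℝ :=
  ∑ i : Fin 3, fderiv ℝ (fun y => fderiv ℝ w y (EuclideanSpace.single i 1)) z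
      (EuclideanSpace.single i 1)

/-- A function on ℝ³ is radial if its value depends only on the norm. -/
def Radial (g : R3 → ℝ) : Prop := ∀ z w : R3, ‖z‖ = ‖w‖ → g z = g w

/-- Assumptions (A1)–(A5) on the nonlinearity: f(u) = u·f₀(u²) with f₀ smooth,
f₀ ≥ 0 on [0,∞), u·f'(u) ∼ f(u), c₁|u|⁵ ≤ |f(u)| ≤ c₂|u|⁵, and the potential
P(u) = ∫₀ᵘ f convex. -/
def NiceF (f : ℝ → ℝ) : Prop :=
  (∃ f₀ : ℝ → ℝ, ContDiff ℝ (⊤ : ℕ∞) f₀ ∧ (∀ v, f v = v * f₀ (v ^ 2)) ∧ ∀ s, 0 ≤ s → 0 ≤ f₀ s) ∧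
  (∃ c₃ c₄ : ℝ, 0 < c₃ ∧ 0 < c₄ ∧
    ∀ v, c₃ * |f v| ≤ |v * deriv f v| ∧ |v * deriv f v| ≤ c₄ * |f v|) ∧
  (∃ c₁ c₂ : ℝ, 0 < c₁ ∧ 0 < c₂ ∧
    ∀ v, c₁ * |v| ^ 5 ≤ |f v| ∧ |f v| ≤ c₂ * |v| ^ 5) ∧
  ConvexOn ℝ Set.univ (fun v => ∫ w in (0:ℝ)..v, f w)

/-- The one-sided form of `abs_sub_le_of_deriv_decay`. -/
theorem sub_le_of_deriv_decay {a n : ℝ → ℝ} {R C x y : ℝ} (hR : 0 < R) (hC : 0 ≤ C)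
    (hx : R ≤ x) (hxy : x ≤ y) (ha : ∀ t, HasDerivAt a (n t) t)
    (hn : ∀ t, x ≤ t → t ≤ y → n t ≤ C / (t + R) ^ 2) : a y - a x ≤ C / (x + R) := by
  have hd : ∀ t, x ≤ t → HasDerivAt (fun t => C / (t + R) + a t)
      (-C / (t + R) ^ 2 + n t) t := fun t ht => by
    have hne : t + R ≠ 0 := by linarith
    have := ((hasDerivAt_const t C).div ((hasDerivAt_id t).add_const R) hne).add (ha t)
    refine this.congr_deriv ?_
    simp
  have hanti : AntitoneOn (fun t => C / (t + R) + a t) (Set.Icc x y) := by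
    apply antitoneOn_of_deriv_nonpos (convex_Icc x y)
    · exact fun t ht => (hd t ht.1).continuousAt.continuousWithinAt
    · intro t ht
      rw [interior_Icc] at ht
      exact (hd t ht.1.le).differentiableAt.differentiableWithinAt
    · intro t ht
      rw [interior_Icc] at ht
      rw [(hd t ht.1.le).deriv, neg_div]
      linarith [hn t ht.1.le ht.2.le]
  have h := hanti (Set.left_mem_Icc.2 hxy) (Set.right_mem_Icc.2 hxy) hxy
  have : 0 ≤ C / (y + R) := div_nonneg hC (by linarith)
  linarith

/-- A function whose derivative decays like `C / (t + R) ^ 2` varies by at most `C / (x + R)`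
on the right of `x`. -/
theorem abs_sub_le_of_deriv_decay {a n : ℝ → ℝ} {R C x y : ℝ} (hR : 0 < R) (hC : 0 ≤ C)
    (hx : R ≤ x) (hxy : x ≤ y) (ha : ∀ t, HasDerivAt a (n t) t)
    (hn : ∀ t, x ≤ t → t ≤ y → |n t| ≤ C / (t + R) ^ 2) : |a y - a x| ≤ C / (x + R) := by
  rw [abs_le]
  constructor
  · have := sub_le_of_deriv_decay (a := fun t => -a t) (n := fun t => -n t) hR hC hx hxy
      (fun t => (ha t).neg) (fun t h1 h2 => (neg_le_abs _).trans (hn t h1 h2))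
    linarith
  · exact sub_le_of_deriv_decay hR hC hx hxy ha (fun t h1 h2 => (le_abs_self _).trans (hn t h1 h2))

/-- A solution `G` of a one-dimensional wave equation in null coordinates, with first derivatives
`A`, `B` and mixed derivative `N`, vanishing on the time slice `x + y = 0`, whose right-hand side
is dominated by `c |G| / (y + R) ^ 2` in the exterior region as long as `|G| ≤ 1`. -/
structure NullWave (G A B N : ℝ → ℝ → ℝ) (R c : ℝ) : Prop where
  left : ∀ x y, HasDerivAt (fun s => G s y) (A x y) x
  right : ∀ x y, HasDerivAt (G x) (B x y) y
  left_right : ∀ x y, HasDerivAt (A x) (N x y) y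
  right_left : ∀ x y, HasDerivAt (fun s => B s y) (N x y) x
  cont : Continuous (fun p : ℝ × ℝ => G p.1 p.2)
  bound : ∀ x y, x ≤ -R → -x ≤ y → |G x y| ≤ 1 → |N x y| ≤ c / (y + R) ^ 2 * |G x y|
  init : ∀ x, G x (-x) = 0

namespace NullWave

variable {G A B N : ℝ → ℝ → ℝ} {R c : ℝ}

/-- A bound for the left derivative up to `x` controls `G` at `x`. -/
theorem abs_le_of_left (h : NullWave G A B N R c) {x₀ x y M : ℝ}
    (hzero : ∀ y, -x₀ ≤ y → G x₀ y = 0) (hx : x₀ ≤ x) (hy : -x ≤ y) (hM : 0 ≤ M)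
    (hA : ∀ s, x₀ ≤ s → s < x → -s ≤ y → |A s y| ≤ M) : |G x y| ≤ M * (x - x₀) := by
  have hax : max x₀ (-y) ≤ x := max_le hx (by linarith)
  have h0 : G (max x₀ (-y)) y = 0 := by
    rcases le_total x₀ (-y) with h1 | h1
    · rw [max_eq_right h1]
      simpa using h.init (-y)
    · rw [max_eq_left h1]
      exact hzero y (by linarith)
  have key := norm_image_sub_le_of_norm_deriv_le_segment' (f := fun s => G s y)
    (f' := fun s => A s y) (a := max x₀ (-y)) (b := x) (C := M)
    (fun s _ => (h.left s y).hasDerivWithinAt)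
    (fun s hs => hA s ((le_max_left _ _).trans hs.1) hs.2
      (by linarith [(le_max_right x₀ (-y)).trans hs.1])) x (Set.right_mem_Icc.2 hax)
  simp only [h0, sub_zero, norm_eq_abs] at key
  refine key.trans (mul_le_mul_of_nonneg_left ?_ hM)
  linarith [le_max_left x₀ (-y)]

/-- Bootstrap: in a thin strip next to a vanishing null line, `G` stays bounded by `1`. -/
theorem abs_le_one (h : NullWave G A B N R c) (hR : 0 < R) (hc : 0 ≤ c) {x₀ x₁ K : ℝ}
    (hx₁ : x₁ ≤ -R) (hzero : ∀ y, -x₀ ≤ y → G x₀ y = 0) (hK0 : 0 ≤ K)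
    (hK : ∀ x, x₀ ≤ x → x ≤ x₁ → |A x (-x)| ≤ K)
    (hε : (K + c / (2 * R)) * (x₁ - x₀) ≤ 1 / 2) {x y : ℝ} (h0 : x₀ ≤ x) (h1 : x ≤ x₁)
    (hy : -x ≤ y) : |G x y| ≤ 1 := by
  by_contra! hbad
  have hL : 0 ≤ c / (2 * R) := by positivity
  let S : Set (ℝ × ℝ) := (Set.Icc x₀ x₁ ×ˢ Set.Icc (-x₁) y) ∩
    {p | -p.1 ≤ p.2 ∧ 1 ≤ |G p.1 p.2|}
  have hS : IsCompact S := by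
    refine (isCompact_Icc.prod isCompact_Icc).inter_right (IsClosed.inter ?_ ?_)
    · exact isClosed_le continuous_fst.neg continuous_snd
    · exact isClosed_le continuous_const h.cont.abs
  have hne : S.Nonempty := ⟨(x, y), ⟨⟨h0, h1⟩, by constructor <;> simp only <;> linarith⟩,
    hy, hbad.le⟩
  obtain ⟨⟨a, b⟩, ⟨⟨⟨ha0, ha1⟩, hb0, hb1⟩, hab, hG⟩, hmin⟩ :=
    hS.exists_isMinOn hne continuous_fst.continuousOn
  simp only at ha0 ha1 hb0 hb1 hab hG
  have hsmall : ∀ s t, x₀ ≤ s → s < a → -s ≤ t → t ≤ y → |G s t| ≤ 1 := by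
    intro s t hs0 hsa hst hty
    by_contra! hcon
    have : a ≤ s := hmin (show (s, t) ∈ S from
      ⟨⟨⟨hs0, by simp only; linarith⟩, by simp only; linarith, hty⟩, hst, hcon.le⟩)
    linarith
  have hA : ∀ s, x₀ ≤ s → s < a → -s ≤ b → |A s b| ≤ K + c / (2 * R) := by
    intro s hs0 hsa hsb
    have h2 := abs_sub_le_of_deriv_decay hR hc (x := -s) (y := b) (by linarith) hsb
      (h.left_right s) (fun t ht0 ht1 => by
        have h3 := hsmall s t hs0 hsa ht0 (by linarith)
        refine (h.bound s t (by linarith) ht0 h3).trans ?_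
        exact mul_le_of_le_one_right (by positivity) h3)
    have h4 : c / (-s + R) ≤ c / (2 * R) :=
      div_le_div_of_nonneg_left hc (by positivity) (by linarith)
    have h5 := hK s hs0 (by linarith)
    have h6 := abs_sub_abs_le_abs_sub (A s b) (A s (-s))
    linarith
  have h7 := h.abs_le_of_left hzero ha0 hab (by positivity) hA
  have h8 : (K + c / (2 * R)) * (a - x₀) ≤ (K + c / (2 * R)) * (x₁ - x₀) :=
    mul_le_mul_of_nonneg_left (by linarith) (by positivity)
  linarith

/-- If the sum of the null derivatives tends to zero along null lines, so does the left
derivative in a strip next to a vanishing null line. -/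
theorem tendsto_left (h : NullWave G A B N R c) {x₀ x : ℝ} (hx : x ≤ -R) (h0 : x₀ ≤ x)
    (hzero : ∀ y, -x₀ ≤ y → G x₀ y = 0)
    (hone : ∀ s y, x₀ ≤ s → s ≤ x → -s ≤ y → |G s y| ≤ 1) (hc : 0 ≤ c)
    (hrad : Tendsto (fun y => A x y + B x y) atTop (nhds 0)) :
    Tendsto (A x) atTop (nhds 0) := by
  have hB : Tendsto (B x) atTop (nhds 0) := by
    have hlim : Tendsto (fun y : ℝ => c / (y + R) ^ 2 * (x - x₀)) atTop (nhds 0) := by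
      have : Tendsto (fun y : ℝ => (y + R) ^ 2) atTop atTop :=
        (tendsto_pow_atTop two_ne_zero).comp (tendsto_atTop_add_const_right _ _ tendsto_id)
      simpa using (this.const_div_atTop c).mul_const (x - x₀)
    refine squeeze_zero_norm' ?_ hlim
    filter_upwards [eventually_gt_atTop (-x₀)] with y hy
    have hB0 : B x₀ y = 0 := by
      have : G x₀ =ᶠ[nhds y] fun _ => 0 := by
        filter_upwards [lt_mem_nhds hy] with t ht using hzero t ht.le
      exact (h.right x₀ y).unique ((hasDerivAt_const y (0 : ℝ)).congr_of_eventuallyEq this)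
    have key := norm_image_sub_le_of_norm_deriv_le_segment' (f := fun s => B s y)
      (f' := fun s => N s y) (a := x₀) (b := x) (C := c / (y + R) ^ 2)
      (fun s _ => (h.right_left s y).hasDerivWithinAt)
      (fun s hs => by
        have h3 := hone s y hs.1 hs.2.le (by linarith [hs.1])
        refine (h.bound s y (by linarith [hs.2]) (by linarith [hs.1]) h3).trans ?_
        exact mul_le_of_le_one_right (by positivity) h3) x (Set.right_mem_Icc.2 h0)
    simpa [hB0] using key
  simpa using hrad.sub hB

/-- Unique continuation from null infinity across a thin strip. -/
theorem eq_zero_strip (h : NullWave G A B N R c) (hR : 0 < R) (hc : 0 ≤ c) {x₀ x₁ K : ℝ}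
    (hx₁ : x₁ ≤ -R) (hzero : ∀ y, -x₀ ≤ y → G x₀ y = 0) (hK0 : 0 ≤ K)
    (hK : ∀ x, x₀ ≤ x → x ≤ x₁ → |A x (-x)| ≤ K)
    (hε : (K + c / (2 * R)) * (x₁ - x₀) ≤ 1 / 2)
    (hrad : ∀ x, x ≤ -R → Tendsto (fun y => A x y + B x y) atTop (nhds 0))
    {x y : ℝ} (h0 : x₀ ≤ x) (h1 : x ≤ x₁) (hy : -x ≤ y) : G x y = 0 := by
  have hL : 0 ≤ c / (2 * R) := by positivity
  have hone : ∀ s t, x₀ ≤ s → s ≤ x₁ → -s ≤ t → |G s t| ≤ 1 := fun s t hs0 hs1 hst =>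
    h.abs_le_one hR hc hx₁ hzero hK0 hK hε hs0 hs1 hst
  have hAlim : ∀ s, x₀ ≤ s → s ≤ x₁ → Tendsto (A s) atTop (nhds 0) := fun s hs0 hs1 =>
    h.tendsto_left (hs1.trans hx₁) hs0 hzero
      (fun r t hr0 hr1 hrt => hone r t hr0 (hr1.trans hs1) hrt) hc (hrad s (hs1.trans hx₁))
  have hiter : ∀ (n : ℕ) s t, x₀ ≤ s → s ≤ x₁ → -s ≤ t → |G s t| ≤ (1 / 2) ^ n := by
    intro n
    induction n with
    | zero => simpa using hone
    | succ n ih =>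
      intro s t hs0 hs1 hst
      have hA : ∀ r, x₀ ≤ r → r < s → -r ≤ t → |A r t| ≤ c / (2 * R) * (1 / 2) ^ n := by
        intro r hr0 hrs hrt
        have hmem : ∀ t', t ≤ t' → |A r t' - A r t| ≤ c / (2 * R) * (1 / 2) ^ n := by
          intro t' ht'
          refine (abs_sub_le_of_deriv_decay hR (C := c * (1 / 2) ^ n) (by positivity)
            (by linarith) ht' (h.left_right r) (fun τ hτ0 _ => ?_)).trans ?_
          · have h2 := h.bound r τ (by linarith) (by linarith)
              (hone r τ hr0 (by linarith) (by linarith))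
            have h3 := mul_le_mul_of_nonneg_left (ih r τ hr0 (by linarith) (by linarith))
              (show 0 ≤ c / (τ + R) ^ 2 by positivity)
            calc _ ≤ _ := h2.trans h3
              _ = _ := by ring
          · rw [div_mul_eq_mul_div]
            exact div_le_div_of_nonneg_left (by positivity) (by positivity) (by linarith)
        have hlim := ((hAlim r hr0 (by linarith)).sub_const (A r t)).abs
        have := le_of_tendsto hlim ((eventually_ge_atTop t).mono hmem)
        simpa using this
      have h4 := h.abs_le_of_left hzero hs0 hst (by positivity) hA
      have h5 : c / (2 * R) * (s - x₀) ≤ 1 / 2 := by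
        refine le_trans ?_ hε
        exact mul_le_mul (by linarith) (by linarith) (by linarith) (by linarith)
      calc _ ≤ _ := h4
        _ = c / (2 * R) * (s - x₀) * (1 / 2) ^ n := by ring
        _ ≤ 1 / 2 * (1 / 2) ^ n := mul_le_mul_of_nonneg_right h5 (by positivity)
        _ = _ := by ring
  have hlim : Tendsto (fun n : ℕ => (1 / 2 : ℝ) ^ n) atTop (nhds 0) :=
    tendsto_pow_atTop_nhds_zero_of_lt_one (by norm_num) (by norm_num)
  exact abs_nonpos_iff.1 (ge_of_tendsto' hlim fun n => hiter n x y h0 h1 hy)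

/-- Unique continuation from null infinity: if `G` vanishes near spatial infinity and its
radiation field vanishes on `x ≤ -R`, then `G` vanishes on the whole exterior region. -/
theorem eq_zero (h : NullWave G A B N R c) (hR : 0 < R) (hc : 0 ≤ c)
    (hA : Continuous (fun x => A x (-x))) {R₀ : ℝ}
    (hfar : ∀ x y, x ≤ -R₀ → -x ≤ y → G x y = 0)
    (hrad : ∀ x, x ≤ -R → Tendsto (fun y => A x y + B x y) atTop (nhds 0))
    {x y : ℝ} (hx : x ≤ -R) (hy : -x ≤ y) : G x y = 0 := by
  obtain ⟨K', hK'⟩ := (isCompact_Icc (a := -R₀) (b := -R)).exists_bound_of_continuousOn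
    hA.continuousOn
  set K := max K' 0
  have hL : 0 ≤ c / (2 * R) := by positivity
  have hK0 : 0 ≤ K := le_max_right _ _
  obtain ⟨ε, hε0, hε⟩ : ∃ ε > 0, (K + c / (2 * R)) * ε ≤ 1 / 2 := by
    refine ⟨1 / (2 * (K + c / (2 * R) + 1)), by positivity, ?_⟩
    rw [mul_one_div, div_le_div_iff₀ (by positivity) (by positivity)]
    linarith
  have hind : ∀ (n : ℕ) x y, x ≤ -R → x ≤ -R₀ + n * ε → -x ≤ y → G x y = 0 := by
    intro n
    induction n with
    | zero => exact fun x y _ hx hy => hfar x y (by simpa using hx) hy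
    | succ n ih =>
      intro x y hxR hx hy
      rcases le_total x (-R₀ + n * ε) with hle | hle
      · exact ih x y hxR hle hy
      · have hn : 0 ≤ n * ε := by positivity
        push_cast at hx
        refine h.eq_zero_strip hR hc (x₀ := -R₀ + n * ε) hxR
          (fun y hy => ih _ y (hle.trans hxR) le_rfl hy) hK0
          (fun s hs0 hs1 => (hK' s ⟨by linarith, by linarith⟩).trans (le_max_left _ _)) ?_ hrad
          hle le_rfl hy
        exact (mul_le_mul_of_nonneg_left (by linarith) (by positivity)).trans hε
  obtain ⟨n, hn⟩ := exists_nat_ge ((x + R₀) / ε)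
  rw [div_le_iff₀ hε0] at hn
  exact hind n x y hx (by linarith) hy

end NullWave

/-- The derivative of `F` in the direction `v`, as a function of the base point. -/
def along {E : Type*} [NormedAddCommGroup E] [NormedSpace ℝ E] (v : E) (F : E → ℝ) : E → ℝ :=
  fun p => fderiv ℝ F p v

section Along

variable {E : Type*} [NormedAddCommGroup E] [NormedSpace ℝ E] {F G : E → ℝ}

theorem contDiff_along (hF : ContDiff ℝ (⊤ : ℕ∞) F) (v : E) :
    ContDiff ℝ (⊤ : ℕ∞) (along v F) :=
  (hF.fderiv_right (m := ((⊤ : ℕ∞) : WithTop ℕ∞)) le_rfl).clm_apply contDiff_const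

theorem differentiable_of_smooth (hF : ContDiff ℝ (⊤ : ℕ∞) F) : Differentiable ℝ F :=
  hF.differentiable (by simp)

theorem along_along (hF : ContDiff ℝ (⊤ : ℕ∞) F) (v w p : E) :
    along v (along w F) p = fderiv ℝ (fderiv ℝ F) p v w := by
  have hd : DifferentiableAt ℝ (fderiv ℝ F) p :=
    (hF.fderiv_right (m := ((⊤ : ℕ∞) : WithTop ℕ∞)) le_rfl).differentiable (by simp) p
  change fderiv ℝ (fun y => fderiv ℝ F y w) p v = _
  rw [fderiv_clm_apply hd (differentiableAt_const w)]
  simp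

theorem along_comm (hF : ContDiff ℝ (⊤ : ℕ∞) F) (v w p : E) :
    along v (along w F) p = along w (along v F) p := by
  rw [along_along hF, along_along hF]
  refine (hF.contDiffAt.isSymmSndFDerivAt ?_).eq v w
  rw [minSmoothness_of_isRCLikeNormedField]
  exact WithTop.coe_le_coe.2 (le_top : (2 : ℕ∞) ≤ ⊤)

theorem along_mul (hF : ContDiff ℝ (⊤ : ℕ∞) F) (hG : ContDiff ℝ (⊤ : ℕ∞) G) (v p : E) :
    along v (fun q => F q * G q) p = along v F p * G p + F p * along v G p := by
  simp only [along]
  rw [fderiv_fun_mul (differentiable_of_smooth hF p) (differentiable_of_smooth hG p)]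
  simp
  ring

theorem along_add (hF : ContDiff ℝ (⊤ : ℕ∞) F) (hG : ContDiff ℝ (⊤ : ℕ∞) G) (v p : E) :
    along v (fun q => F q + G q) p = along v F p + along v G p := by
  simp only [along]
  rw [fderiv_fun_add (differentiable_of_smooth hF p) (differentiable_of_smooth hG p)]
  simp

theorem along_sub (hF : ContDiff ℝ (⊤ : ℕ∞) F) (hG : ContDiff ℝ (⊤ : ℕ∞) G) (v p : E) :
    along v (fun q => F q - G q) p = along v F p - along v G p := by
  simp only [along]
  rw [fderiv_fun_sub (differentiable_of_smooth hF p) (differentiable_of_smooth hG p)]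
  simp

theorem along_sq (hF : ContDiff ℝ (⊤ : ℕ∞) F) (v p : E) :
    along v (fun q => F q ^ 2) p = 2 * F p * along v F p := by
  simp only [sq]
  rw [along_mul hF hF]
  ring

theorem along_sum {ι : Type*} [Fintype ι] {H : ι → E → ℝ}
    (hH : ∀ i, ContDiff ℝ (⊤ : ℕ∞) (H i)) (v p : E) :
    along v (fun q => ∑ i, H i q) p = ∑ i, along v (H i) p := by
  simp only [along]
  rw [fderiv_fun_sum fun i _ => differentiable_of_smooth (hH i) p]
  simp

end Along

section Slices

variable {F : ℝ × R3 → ℝ}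

theorem hasDerivAt_slice (hF : ContDiff ℝ (⊤ : ℕ∞) F) (t : ℝ) (z : R3) :
    HasDerivAt (fun s => F (s, z)) (along (1, 0) F (t, z)) t := by
  have h1 : HasDerivAt (fun s : ℝ => (s, z)) ((1 : ℝ), (0 : R3)) t :=
    (hasDerivAt_id t).prodMk (hasDerivAt_const t z)
  exact (differentiable_of_smooth hF (t, z)).hasFDerivAt.comp_hasDerivAt t h1

theorem along_slice (hF : ContDiff ℝ (⊤ : ℕ∞) F) (t : ℝ) (z w : R3) :
    along w (fun y => F (t, y)) z = along (0, w) F (t, z) := by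
  have h1 : HasFDerivAt (fun y : R3 => (t, y)) (ContinuousLinearMap.inr ℝ ℝ R3) z :=
    hasFDerivAt_prodMk_right t z
  have h2 := (differentiable_of_smooth hF (t, z)).hasFDerivAt.comp z h1
  have h3 : fderiv ℝ (fun y => F (t, y)) z = _ := h2.fderiv
  simp [along, h3]

theorem smooth_slice (hF : ContDiff ℝ (⊤ : ℕ∞) F) (t : ℝ) :
    ContDiff ℝ (⊤ : ℕ∞) (fun y => F (t, y)) :=
  hF.comp (contDiff_const.prodMk contDiff_id)

/-- Differentiation under the integral sign for smooth functions with locally uniformly bounded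
spatial support. -/
theorem hasDerivAt_integral_slice (hF : ContDiff ℝ (⊤ : ℕ∞) F) {t₀ ρ : ℝ} {z₀ : R3}
    (hs : ∀ t ∈ ball t₀ 1, ∀ z, ρ < dist z z₀ → F (t, z) = 0) :
    Integrable (fun z => along (1, 0) F (t₀, z)) ∧
      HasDerivAt (fun t => ∫ z, F (t, z)) (∫ z, along (1, 0) F (t₀, z)) t₀ := by
  have hcont := (contDiff_along hF (1, 0)).continuous
  have hcpt : IsCompact (closedBall t₀ 1 ×ˢ closedBall z₀ ρ) :=
    (isCompact_closedBall _ _).prod (isCompact_closedBall _ _)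
  obtain ⟨M, hM⟩ := hcpt.exists_bound_of_continuousOn hcont.continuousOn
  have hsupp : ∀ t ∈ ball t₀ 1, ∀ z, ρ < dist z z₀ → along (1, 0) F (t, z) = 0 := by
    intro t ht z hz
    have : (fun s => F (s, z)) =ᶠ[nhds t] fun _ => 0 := by
      filter_upwards [isOpen_ball.mem_nhds ht] with s hs' using hs s hs' z hz
    exact (hasDerivAt_slice hF t z).unique
      ((hasDerivAt_const t (0 : ℝ)).congr_of_eventuallyEq this)
  have hint : Integrable (fun z => F (t₀, z)) := by
    refine (smooth_slice hF t₀).continuous.integrable_of_hasCompactSupport ?_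
    refine HasCompactSupport.intro (isCompact_closedBall z₀ ρ) fun z hz => ?_
    exact hs t₀ (mem_ball_self one_pos) z (by simpa using hz)
  refine hasDerivAt_integral_of_dominated_loc_of_deriv_le (ball_mem_nhds t₀ one_pos)
    (F := fun t z => F (t, z)) (F' := fun t z => along (1, 0) F (t, z))
    (bound := (closedBall z₀ ρ).indicator fun _ => M)
    (Eventually.of_forall fun t => (smooth_slice hF t).continuous.aestronglyMeasurable) hint
    (hcont.comp (by fun_prop : Continuous fun z : R3 => (t₀, z))).aestronglyMeasurable ?_ ?_ ?_
  · refine Eventually.of_forall fun z t ht => ?_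
    by_cases hz : z ∈ closedBall z₀ ρ
    · rw [Set.indicator_of_mem hz]
      exact hM (t, z) ⟨ball_subset_closedBall ht, hz⟩
    · rw [Set.indicator_of_notMem hz, hsupp t ht z (by simpa using hz), norm_zero]
  · refine IntegrableOn.integrable_indicator ?_ measurableSet_closedBall
    exact integrableOn_const (measure_closedBall_lt_top.ne)
  · exact Eventually.of_forall fun z t _ => hasDerivAt_slice hF t z

end Slices

/-- The integral of a directional derivative of a compactly supported function vanishes. -/
theorem integral_along_eq_zero {g : R3 → ℝ} (hg : ContDiff ℝ (⊤ : ℕ∞) g)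
    (hc : HasCompactSupport g) (v : R3) :
    Integrable (along v g) ∧ ∫ z, along v g z = 0 := by
  have hi : Integrable (along v g) :=
    (contDiff_along hg v).continuous.integrable_of_hasCompactSupport (hc.fderiv_apply ℝ v)
  refine ⟨hi, ?_⟩
  have := integral_mul_fderiv_eq_neg_fderiv_mul_of_integrable (μ := (volume : Measure R3))
    (f := fun _ : R3 => (1 : ℝ)) (g := g) (v := v) (by simp)
    (by simp only [one_mul]; exact hi)
    (by simpa using hg.continuous.integrable_of_hasCompactSupport hc)
    (fun x _ => differentiableAt_const _) (fun x _ => differentiable_of_smooth hg x)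
  simpa [along] using this

/-- A smooth weight, positive exactly in the backward light cone with tip `(T, z₀)` (and in its
reflection). -/
def coneWeight (T : ℝ) (z₀ : R3) (p : ℝ × R3) : ℝ :=
  expNegInvGlue ((T - p.1) ^ 2 - ‖p.2 - z₀‖ ^ 2)

section ConeWeight

variable {T : ℝ} {z₀ : R3}

theorem smooth_coneWeight : ContDiff ℝ (⊤ : ℕ∞) (coneWeight T z₀) := by
  refine expNegInvGlue.contDiff.comp ?_
  exact ((contDiff_const.sub contDiff_fst).pow 2).sub
    ((contDiff_snd.sub contDiff_const).norm_sq ℝ)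

theorem coneWeight_eq_zero {p : ℝ × R3} (h : (T - p.1) ^ 2 ≤ ‖p.2 - z₀‖ ^ 2) :
    coneWeight T z₀ p = 0 :=
  expNegInvGlue.zero_of_nonpos (by linarith)

theorem along_coneWeight (v p : ℝ × R3) :
    along v (coneWeight T z₀) p = deriv expNegInvGlue ((T - p.1) ^ 2 - ‖p.2 - z₀‖ ^ 2) *
      (-(2 * (T - p.1) * v.1) - 2 * inner ℝ (p.2 - z₀) v.2) := by
  have h1 : HasFDerivAt (fun q : ℝ × R3 => (T - q.1) ^ 2 - ‖q.2 - z₀‖ ^ 2) _ p :=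
    ((hasFDerivAt_fst.const_sub T).pow 2).sub ((hasFDerivAt_snd.sub_const z₀).norm_sq)
  have h2 : HasDerivAt expNegInvGlue _ ((T - p.1) ^ 2 - ‖p.2 - z₀‖ ^ 2) :=
    ((expNegInvGlue.contDiff (n := 1)).differentiable (by simp) _).hasDerivAt
  have h3 : HasFDerivAt (coneWeight T z₀) _ p := h2.comp_hasFDerivAt p h1
  rw [along, h3.fderiv]
  simp [inner_sub_left]

theorem deriv_expNegInvGlue_nonneg (x : ℝ) : 0 ≤ deriv expNegInvGlue x :=
  expNegInvGlue.monotone.deriv_nonneg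

theorem deriv_expNegInvGlue_of_nonpos {x : ℝ} (hx : x ≤ 0) : deriv expNegInvGlue x = 0 := by
  have : IsLocalMin expNegInvGlue x := Eventually.of_forall fun y => by
    rw [expNegInvGlue.zero_of_nonpos hx]
    exact expNegInvGlue.nonneg y
  exact this.deriv_eq_zero

end ConeWeight

/-- The energy density of `F` (including the lower order term). -/
def energyDensity (F : ℝ × R3 → ℝ) (p : ℝ × R3) : ℝ :=
  along (1, 0) F p ^ 2 + ∑ i : Fin 3, along (0, EuclideanSpace.single i 1) F p ^ 2 + F p ^ 2

section Energy

variable {F : ℝ × R3 → ℝ}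

theorem smooth_energyDensity (hF : ContDiff ℝ (⊤ : ℕ∞) F) :
    ContDiff ℝ (⊤ : ℕ∞) (energyDensity F) := by
  refine (((contDiff_along hF _).pow 2).add ?_).add (hF.pow 2)
  exact ContDiff.sum fun i _ => (contDiff_along hF _).pow 2

theorem energyDensity_nonneg (p : ℝ × R3) : 0 ≤ energyDensity F p := by
  unfold energyDensity
  positivity

theorem along_energyDensity (hF : ContDiff ℝ (⊤ : ℕ∞) F) (v p : ℝ × R3) :
    along v (energyDensity F) p = 2 * along (1, 0) F p * along v (along (1, 0) F) p +
      ∑ i : Fin 3, 2 * along (0, EuclideanSpace.single i 1) F p *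
        along v (along (0, EuclideanSpace.single i 1) F) p + 2 * F p * along v F p := by
  have h1 := contDiff_along hF
  have h2 : ∀ i : Fin 3, ContDiff ℝ (⊤ : ℕ∞)
      (fun q => along (0, EuclideanSpace.single i 1) F q ^ 2) := fun i => (h1 _).pow 2
  have h3 := along_add (((h1 (1, 0)).pow 2).add (ContDiff.sum fun i (_ : i ∈ Finset.univ) => h2 i))
    (hF.pow 2) v p
  have h4 := along_add ((h1 (1, 0)).pow 2) (ContDiff.sum fun i (_ : i ∈ Finset.univ) => h2 i) v p
  change along v (fun q => along (1, 0) F q ^ 2 +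
    ∑ i : Fin 3, along (0, EuclideanSpace.single i 1) F q ^ 2 + F q ^ 2) p = _
  rw [h3, h4, along_sum h2, along_sq hF, along_sq (h1 _)]
  simp only [along_sq (h1 _)]

/-- The algebraic heart of the energy estimate: the energy flux through the boundary of a light
cone is dominated by the energy. -/
theorem cone_flux_le {ι : Type*} [Fintype ι] {τ a d : ℝ} {y b : ι → ℝ} (hτ : 0 < τ)
    (hy : ∑ i, y i ^ 2 ≤ τ ^ 2) :
    2 * (a * ∑ i, y i * b i) ≤ τ * (a ^ 2 + ∑ i, b i ^ 2 + d ^ 2) := by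
  have h1 := Finset.sum_mul_sq_le_sq_mul_sq Finset.univ y b
  have hB : 0 ≤ ∑ i, b i ^ 2 := Finset.sum_nonneg fun i _ => sq_nonneg _
  have h2 := mul_le_mul_of_nonneg_right hy hB
  set s := ∑ i, y i * b i
  set B := ∑ i, b i ^ 2
  have h3 : 0 ≤ τ * (τ * (a ^ 2 + B + d ^ 2) - 2 * (a * s)) := by
    nlinarith [sq_nonneg (τ * a - s), sq_nonneg (τ * d)]
  linarith [nonneg_of_mul_nonneg_right h3 hτ]

/-- Pointwise energy inequality, modulo a spatial divergence. -/
theorem along_weighted_energy_le (hF : ContDiff ℝ (⊤ : ℕ∞) F) {T C t : ℝ} {z₀ z : R3}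
    (hC : 0 ≤ C) (ht : t < T)
    (hbd : ‖z - z₀‖ ≤ T - t → |along (1, 0) (along (1, 0) F) (t, z) -
      ∑ i : Fin 3, along (0, EuclideanSpace.single i 1)
        (along (0, EuclideanSpace.single i 1) F) (t, z)| ≤ C * |F (t, z)|) :
    along (1, 0) (fun p => coneWeight T z₀ p * energyDensity F p) (t, z) -
      ∑ i : Fin 3, along (0, EuclideanSpace.single i 1) (fun p => coneWeight T z₀ p *
        (2 * along (1, 0) F p * along (0, EuclideanSpace.single i 1) F p)) (t, z) ≤
      (C + 1) * (coneWeight T z₀ (t, z) * energyDensity F (t, z)) := by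
  have h1 := contDiff_along hF
  have h2 : ContDiff ℝ (⊤ : ℕ∞) (fun p => 2 * along (1, 0) F p) := contDiff_const.mul (h1 _)
  have h2' : ∀ v p, along v (fun p => 2 * along (1, 0) F p) p =
      2 * along v (along (1, 0) F) p := fun v p => by
    rw [along_mul contDiff_const (h1 _)]
    simp [along]
  rw [along_mul smooth_coneWeight (smooth_energyDensity hF), along_energyDensity hF]
  simp only [along_mul smooth_coneWeight (h2.mul (h1 _)), along_mul h2 (h1 _), h2',
    along_coneWeight]
  have hinner : ∀ i : Fin 3, inner ℝ (z - z₀) (EuclideanSpace.single i (1 : ℝ)) =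
      (z - z₀) i := fun i => by
    rw [EuclideanSpace.inner_single_right]
    simp
  simp only [hinner, inner_zero_right, mul_zero, mul_one, sub_zero, neg_zero, zero_sub]
  have hcomm : ∀ i : Fin 3, along (1, 0) (along (0, EuclideanSpace.single i 1) F) (t, z) =
      along (0, EuclideanSpace.single i 1) (along (1, 0) F) (t, z) := fun i =>
    along_comm hF _ _ _
  simp only [hcomm]
  have hk := deriv_expNegInvGlue_nonneg ((T - t) ^ 2 - ‖z - z₀‖ ^ 2)
  have hk0 : (T - t) ^ 2 - ‖z - z₀‖ ^ 2 ≤ 0 →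
      deriv expNegInvGlue ((T - t) ^ 2 - ‖z - z₀‖ ^ 2) = 0 :=
    deriv_expNegInvGlue_of_nonpos
  have hφ : 0 ≤ coneWeight T z₀ (t, z) := expNegInvGlue.nonneg _
  have hφ0 : (T - t) ^ 2 - ‖z - z₀‖ ^ 2 ≤ 0 → coneWeight T z₀ (t, z) = 0 := fun h =>
    coneWeight_eq_zero (by simpa using h)
  have hnorm : ‖z - z₀‖ ^ 2 = ∑ i, (z - z₀) i ^ 2 := EuclideanSpace.real_norm_sq_eq _
  have hle : ¬ (T - t) ^ 2 - ‖z - z₀‖ ^ 2 ≤ 0 → ‖z - z₀‖ ≤ T - t := fun h =>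
    abs_le_of_sq_le_sq' (by linarith) (by linarith) |>.2
  have he : energyDensity F (t, z) = along (1, 0) F (t, z) ^ 2 +
    ∑ i : Fin 3, along (0, EuclideanSpace.single i 1) F (t, z) ^ 2 + F (t, z) ^ 2 := rfl
  rw [he]
  generalize deriv expNegInvGlue ((T - t) ^ 2 - ‖z - z₀‖ ^ 2) = k at *
  generalize coneWeight T z₀ (t, z) = φ at *
  generalize along (1, 0) F (t, z) = a at *
  generalize along (1, 0) (along (1, 0) F) (t, z) = a' at *
  generalize F (t, z) = d at *
  generalize hb : (fun i : Fin 3 => along (0, EuclideanSpace.single i 1) F (t, z)) = b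
  generalize hb' : (fun i : Fin 3 => along (0, EuclideanSpace.single i 1)
    (along (1, 0) F) (t, z)) = b'
  generalize hbb : (fun i : Fin 3 => along (0, EuclideanSpace.single i 1)
    (along (0, EuclideanSpace.single i 1) F) (t, z)) = bb
  have hb i : along (0, EuclideanSpace.single i 1) F (t, z) = b i := congrFun hb i
  have hb' i : along (0, EuclideanSpace.single i 1) (along (1, 0) F) (t, z) = b' i :=
    congrFun hb' i
  have hbb i : along (0, EuclideanSpace.single i 1)
    (along (0, EuclideanSpace.single i 1) F) (t, z) = bb i := congrFun hbb i
  simp only [hb, hb', hbb] at *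
  by_cases hcase : (T - t) ^ 2 - ‖z - z₀‖ ^ 2 ≤ 0
  · rw [hk0 hcase, hφ0 hcase]
    simp
  · have hflux := cone_flux_le (a := a) (d := d) (b := b) (y := fun i => (z - z₀) i)
      (show 0 < T - t by linarith) (by rw [← hnorm]; linarith)
    have hflux' := mul_le_mul_of_nonneg_left hflux hk
    have hb1 := hbd (hle hcase)
    have hsrc : 2 * (a * (a' - ∑ i, bb i)) + 2 * (a * d) ≤
        (C + 1) * (a ^ 2 + ∑ i, b i ^ 2 + d ^ 2) := by
      have hB : 0 ≤ ∑ i, b i ^ 2 := Finset.sum_nonneg fun i _ => sq_nonneg _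
      have h3 : a * (a' - ∑ i, bb i) ≤ |a| * (C * |d|) :=
        (le_abs_self _).trans (by rw [abs_mul]; exact mul_le_mul_of_nonneg_left hb1 (abs_nonneg a))
      have h4 : a * d ≤ |a| * |d| := (le_abs_self _).trans (abs_mul a d).le
      have h5 : 2 * (|a| * |d|) ≤ a ^ 2 + d ^ 2 := by
        rw [← sq_abs a, ← sq_abs d]
        nlinarith [sq_nonneg (|a| - |d|)]
      nlinarith [mul_le_mul_of_nonneg_left h5 hC, mul_nonneg hC hB]
    have hsrc' := mul_le_mul_of_nonneg_left hsrc hφ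
    simp only [Fin.sum_univ_three] at *
    linarith

end Energy

/-- Finite speed of propagation: a function satisfying a wave inequality whose Cauchy data vanish
on a ball vanishes in the light cone over this ball. -/
theorem eq_zero_of_wave_inequality {F : ℝ × R3 → ℝ} (hF : ContDiff ℝ (⊤ : ℕ∞) F) {T C : ℝ}
    {z₀ : R3} (hC : 0 ≤ C)
    (hbd : ∀ t z, 0 ≤ t → ‖z - z₀‖ ≤ T - t → |along (1, 0) (along (1, 0) F) (t, z) -
      ∑ i : Fin 3, along (0, EuclideanSpace.single i 1)
        (along (0, EuclideanSpace.single i 1) F) (t, z)| ≤ C * |F (t, z)|)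
    (h0 : ∀ z, ‖z - z₀‖ < T → F (0, z) = 0)
    (h1 : ∀ z, ‖z - z₀‖ < T → along (1, 0) F (0, z) = 0)
    {t₁ : ℝ} {z₁ : R3} (ht₁ : 0 ≤ t₁) (hz₁ : ‖z₁ - z₀‖ < T - t₁) : F (t₁, z₁) = 0 := by
  have ht₁T : t₁ < T := by linarith [norm_nonneg (z₁ - z₀)]
  set h : ℝ × R3 → ℝ := fun p => coneWeight T z₀ p * energyDensity F p with hh
  have hsm : ContDiff ℝ (⊤ : ℕ∞) h := smooth_coneWeight.mul (smooth_energyDensity hF)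
  have hnn : ∀ p, 0 ≤ h p := fun p =>
    mul_nonneg (expNegInvGlue.nonneg _) (energyDensity_nonneg p)
  have hw0 : ∀ t z, |T - t| ≤ dist z z₀ → coneWeight T z₀ (t, z) = 0 := fun t z hz => by
    refine coneWeight_eq_zero ?_
    rw [dist_eq_norm] at hz
    exact sq_le_sq.2 (by simpa using hz)
  have hsupp : ∀ t₀, ∀ t ∈ ball t₀ 1, ∀ z, |T - t₀| + 1 < dist z z₀ → h (t, z) = 0 := by
    intro t₀ t ht z hz
    have : |T - t| ≤ dist z z₀ := by
      rw [mem_ball, dist_comm, Real.dist_eq] at ht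
      have := abs_sub_le T t₀ t
      linarith
    simp [hh, hw0 t z this]
  have hint : ∀ t, Integrable fun z => h (t, z) := fun t => by
    refine (smooth_slice hsm t).continuous.integrable_of_hasCompactSupport ?_
    refine HasCompactSupport.intro (isCompact_closedBall z₀ (|T - t| + 1)) fun z hz => ?_
    exact hsupp t t (mem_ball_self one_pos) z (by simpa using hz)
  have hE := fun t => hasDerivAt_integral_slice hsm (hsupp t)
  have hE' : ∀ t, 0 ≤ t → t < T →
      ∫ z, along (1, 0) h (t, z) ≤ (C + 1) * ∫ z, h (t, z) := by
    intro t ht0 htT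
    have hflux : ∀ i : Fin 3, ContDiff ℝ (⊤ : ℕ∞) (fun p => coneWeight T z₀ p *
        (2 * along (1, 0) F p * along (0, EuclideanSpace.single i 1) F p)) := fun i =>
      smooth_coneWeight.mul ((contDiff_const.mul (contDiff_along hF _)).mul (contDiff_along hF _))
    have hdiv : ∀ i : Fin 3, Integrable (fun z => along (0, EuclideanSpace.single i 1)
        (fun p => coneWeight T z₀ p * (2 * along (1, 0) F p *
          along (0, EuclideanSpace.single i 1) F p)) (t, z)) ∧
        ∫ z, along (0, EuclideanSpace.single i 1)
          (fun p => coneWeight T z₀ p * (2 * along (1, 0) F p *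
            along (0, EuclideanSpace.single i 1) F p)) (t, z) = 0 := fun i => by
      have := integral_along_eq_zero (smooth_slice (hflux i) t)
        (HasCompactSupport.intro (isCompact_closedBall z₀ |T - t|) fun z hz => by
          rw [hw0 t z (by simpa using (lt_of_not_ge hz).le), zero_mul])
        (EuclideanSpace.single i 1)
      rwa [funext fun z => along_slice (hflux i) t z (EuclideanSpace.single i 1)] at this
    have hdivz : ∫ z, ∑ i : Fin 3, along (0, EuclideanSpace.single i 1)
        (fun p => coneWeight T z₀ p * (2 * along (1, 0) F p *
          along (0, EuclideanSpace.single i 1) F p)) (t, z) = 0 := by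
      rw [integral_finsetSum _ fun i _ => (hdiv i).1]
      simp only [(hdiv _).2, Finset.sum_const_zero]
    have hsumint := integrable_finsetSum Finset.univ fun i _ => (hdiv i).1
    calc ∫ z, along (1, 0) h (t, z)
        = ∫ z, (along (1, 0) h (t, z) - ∑ i : Fin 3, along (0, EuclideanSpace.single i 1)
          (fun p => coneWeight T z₀ p * (2 * along (1, 0) F p *
            along (0, EuclideanSpace.single i 1) F p)) (t, z)) := by
          rw [integral_sub (hE t).1 hsumint, hdivz, sub_zero]
      _ ≤ ∫ z, (C + 1) * h (t, z) :=
          integral_mono ((hE t).1.sub hsumint) ((hint t).const_mul _) fun z =>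
            along_weighted_energy_le hF hC htT (hbd t z ht0)
      _ = _ := integral_const_mul _ _
  have hE0 : ∫ z, h (0, z) = 0 := by
    have : ∀ z, h (0, z) = 0 := by
      intro z
      by_cases hz : ‖z - z₀‖ < T
      · have hopen : IsOpen {y : R3 | ‖y - z₀‖ < T} := isOpen_lt (by fun_prop) (by fun_prop)
        have hsp : ∀ i : Fin 3, along (0, EuclideanSpace.single i 1) F (0, z) = 0 := by
          intro i
          rw [← along_slice hF]
          have : (fun y => F (0, y)) =ᶠ[nhds z] fun _ => 0 := by
            filter_upwards [hopen.mem_nhds hz] with y hy using h0 y hy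
          simp [along, this.fderiv_eq]
        simp [hh, energyDensity, hsp, h0 z hz, h1 z hz]
      · have hT : |T - 0| ≤ dist z z₀ := by
          rw [sub_zero, abs_of_pos (by linarith), dist_eq_norm]
          exact not_lt.1 hz
        simp [hh, hw0 0 z hT]
    simp [this]
  have hanti : AntitoneOn (fun t => Real.exp (-(C + 1) * t) * ∫ z, h (t, z))
      (Set.Icc 0 t₁) := by
    have hd : ∀ t, HasDerivAt (fun t => Real.exp (-(C + 1) * t) * ∫ z, h (t, z))
        (Real.exp (-(C + 1) * t) * (-(C + 1)) * (∫ z, h (t, z)) +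
          Real.exp (-(C + 1) * t) * ∫ z, along (1, 0) h (t, z)) t := fun t => by
      have : HasDerivAt (fun t : ℝ => -(C + 1) * t) (-(C + 1)) t := by
        simpa using (hasDerivAt_id t).const_mul (-(C + 1))
      exact this.exp.mul (hE t).2
    refine antitoneOn_of_deriv_nonpos (convex_Icc _ _)
      (fun t _ => (hd t).continuousAt.continuousWithinAt)
      (fun t _ => (hd t).differentiableAt.differentiableWithinAt) fun t ht => ?_
    rw [interior_Icc] at ht
    rw [(hd t).deriv]
    have := mul_le_mul_of_nonneg_left (hE' t ht.1.le (ht.2.trans ht₁T))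
      (Real.exp_pos (-(C + 1) * t)).le
    linarith
  have hle := hanti (Set.left_mem_Icc.2 ht₁) (Set.right_mem_Icc.2 ht₁) ht₁
  simp only [hE0, mul_zero] at hle
  have hEz : ∫ z, h (t₁, z) = 0 :=
    le_antisymm (nonpos_of_mul_nonpos_right hle (Real.exp_pos _))
      (integral_nonneg fun z => hnn _)
  have hae := (integral_eq_zero_iff_of_nonneg (fun z => hnn _) (hint t₁)).1 hEz
  have hz := congrFun ((smooth_slice hsm t₁).continuous.ae_eq_iff_eq volume
    continuous_const |>.1 hae) z₁
  have hpos : 0 < coneWeight T z₀ (t₁, z₁) := by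
    refine expNegInvGlue.pos_of_pos (sub_pos.2 ?_)
    exact pow_lt_pow_left₀ hz₁ (norm_nonneg _) two_ne_zero
  have he : energyDensity F (t₁, z₁) = 0 := by
    rcases mul_eq_zero.1 hz with h' | h'
    · exact absurd h' hpos.ne'
    · exact h'
  unfold energyDensity at he
  have hs : 0 ≤ ∑ i : Fin 3, along (0, EuclideanSpace.single i 1) F (t₁, z₁) ^ 2 :=
    Finset.sum_nonneg fun i _ => sq_nonneg _
  have : F (t₁, z₁) ^ 2 = 0 := by
    nlinarith [sq_nonneg (along (1, 0) F (t₁, z₁)), sq_nonneg (F (t₁, z₁))]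
  exact pow_eq_zero_iff two_ne_zero |>.1 this

/-- The semilinear wave equation for a function on space-time. -/
def SolvesWave (f : ℝ → ℝ) (F : ℝ × R3 → ℝ) : Prop :=
  ∀ p, along (1, 0) (along (1, 0) F) p - ∑ i : Fin 3, along (0, EuclideanSpace.single i 1)
    (along (0, EuclideanSpace.single i 1) F) p + f (F p) = 0

/-- Uniqueness for the semilinear wave equation in light cones. -/
theorem SolvesWave.eq_of_eq_on_ball {f : ℝ → ℝ} (hf : ContDiff ℝ (⊤ : ℕ∞) f) {F G : ℝ × R3 → ℝ}
    (hF : ContDiff ℝ (⊤ : ℕ∞) F) (hG : ContDiff ℝ (⊤ : ℕ∞) G) (hFw : SolvesWave f F)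
    (hGw : SolvesWave f G) {T : ℝ} {z₀ : R3} (h0 : ∀ z, ‖z - z₀‖ < T → F (0, z) = G (0, z))
    (h1 : ∀ z, ‖z - z₀‖ < T → along (1, 0) F (0, z) = along (1, 0) G (0, z))
    {t : ℝ} {z : R3} (ht : 0 ≤ t) (hz : ‖z - z₀‖ < T - t) : F (t, z) = G (t, z) := by
  have hK : IsCompact (Set.Icc 0 T ×ˢ closedBall z₀ T) :=
    isCompact_Icc.prod (isCompact_closedBall _ _)
  obtain ⟨M₁, hM₁⟩ := hK.exists_bound_of_continuousOn hF.continuous.continuousOn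
  obtain ⟨M₂, hM₂⟩ := hK.exists_bound_of_continuousOn hG.continuous.continuousOn
  set M := max M₁ M₂
  have hf' : Continuous (deriv f) := hf.continuous_deriv (by simp)
  obtain ⟨C, hC⟩ := (isCompact_Icc (a := -M) (b := M)).exists_bound_of_continuousOn
    hf'.continuousOn
  have hd := hF.sub hG
  refine sub_eq_zero.1 (eq_zero_of_wave_inequality hd (T := T) (z₀ := z₀) (C := max C 0)
    (le_max_right _ _) ?_ (fun z hz => sub_eq_zero.2 (h0 z hz))
    (fun z hz => by rw [along_sub hF hG, h1 z hz, sub_self]) ht hz)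
  intro t z ht hz
  have hmem : (t, z) ∈ Set.Icc 0 T ×ˢ closedBall z₀ T := by
    refine ⟨⟨ht, by linarith [norm_nonneg (z - z₀)]⟩, ?_⟩
    rw [mem_closedBall, dist_eq_norm]
    linarith
  have hFM : F (t, z) ∈ Set.Icc (-M) M := abs_le.1 ((hM₁ _ hmem).trans (le_max_left _ _))
  have hGM : G (t, z) ∈ Set.Icc (-M) M := abs_le.1 ((hM₂ _ hmem).trans (le_max_right _ _))
  have hlip := (convex_Icc (-M) M).norm_image_sub_le_of_norm_deriv_le
    (fun x _ => hf.differentiable (by simp) x) hC hGM hFM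
  have hsub : ∀ v, along v (fun q => F q - G q) = fun q => along v F q - along v G q :=
    fun v => funext (along_sub hF hG v)
  simp only [hsub, along_sub (contDiff_along hF _) (contDiff_along hG _),
    Finset.sum_sub_distrib]
  have h2 := hFw (t, z)
  have h3 := hGw (t, z)
  have h4 : ∀ a b c d : ℝ, a - b + f (F (t, z)) = 0 → c - d + f (G (t, z)) = 0 →
      |a - c - (b - d)| ≤ max C 0 * |F (t, z) - G (t, z)| := fun a b c d hab hcd => by
    rw [show a - c - (b - d) = -(f (F (t, z)) - f (G (t, z))) by linarith, abs_neg]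
    exact hlip.trans (mul_le_mul_of_nonneg_right (le_max_left _ _) (abs_nonneg _))
  exact h4 _ _ _ _ h2 h3

theorem along_comp_clm {E E' : Type*} [NormedAddCommGroup E] [NormedSpace ℝ E]
    [NormedAddCommGroup E'] [NormedSpace ℝ E'] {F : E' → ℝ} (hF : ContDiff ℝ (⊤ : ℕ∞) F)
    (L : E →L[ℝ] E') (v p : E) : along v (fun q => F (L q)) p = along (L v) F (L p) := by
  have h := (differentiable_of_smooth hF (L p)).hasFDerivAt.comp p L.hasFDerivAt
  have h' : fderiv ℝ (fun q => F (L q)) p = _ := h.fderiv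
  simp [along, h']

theorem along_add_dir {E : Type*} [NormedAddCommGroup E] [NormedSpace ℝ E] (F : E → ℝ)
    (v w p : E) : along (v + w) F p = along v F p + along w F p :=
  map_add _ _ _

theorem along_smul_dir {E : Type*} [NormedAddCommGroup E] [NormedSpace ℝ E] (F : E → ℝ)
    (a : ℝ) (v p : E) : along (a • v) F p = a * along v F p :=
  map_smul _ _ _

/-- The Laplacian may be computed in any orthonormal basis. -/
theorem sum_along_along_eq {g : R3 → ℝ} (hg : ContDiff ℝ (⊤ : ℕ∞) g)
    (b b' : OrthonormalBasis (Fin 3) ℝ R3) (z : R3) :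
    ∑ i, along (b i) (along (b i) g) z = ∑ i, along (b' i) (along (b' i) g) z := by
  have h : ∀ c : OrthonormalBasis (Fin 3) ℝ R3, ∑ i, along (c i) (along (c i) g) z =
      InnerProductSpace.laplacianWithin g Set.univ z := fun c => by
    rw [InnerProductSpace.laplacianWithin_univ,
      InnerProductSpace.laplacian_eq_iteratedFDeriv_orthonormalBasis g c]
    simp [along_along hg, iteratedFDeriv_two_apply]
  rw [h, h]

theorem along_along_slice {F : ℝ × R3 → ℝ} (hF : ContDiff ℝ (⊤ : ℕ∞) F) (t : ℝ) (z v w : R3) :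
    along v (along w (fun y => F (t, y))) z = along (0, v) (along (0, w) F) (t, z) := by
  rw [funext fun y => along_slice hF t y w, along_slice (contDiff_along hF _)]

/-- The semilinear wave equation is invariant under linear isometries. -/
theorem SolvesWave.comp_isometry {f : ℝ → ℝ} {F : ℝ × R3 → ℝ} (hF : ContDiff ℝ (⊤ : ℕ∞) F)
    (hFw : SolvesWave f F) (Q : R3 ≃ₗᵢ[ℝ] R3) : SolvesWave f (fun p => F (p.1, Q p.2)) := by
  rintro ⟨t, z⟩
  let L : ℝ × R3 →L[ℝ] ℝ × R3 :=
    (ContinuousLinearMap.id ℝ ℝ).prodMap (Q.toContinuousLinearEquiv : R3 →L[ℝ] R3)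
  have hL : ∀ v : ℝ × R3, L v = (v.1, Q v.2) := fun v => rfl
  have h2 : ∀ v w p, along v (along w (fun q => F (L q))) p = along (L v) (along (L w) F) (L p) :=
    fun v w p => by
      rw [funext fun q => along_comp_clm hF L w q, along_comp_clm (contDiff_along hF _)]
  change along (1, 0) (along (1, 0) (fun q => F (L q))) (t, z) -
    ∑ i : Fin 3, along (0, EuclideanSpace.single i 1)
      (along (0, EuclideanSpace.single i 1) (fun q => F (L q))) (t, z) + f (F (L (t, z))) = 0
  simp only [h2]
  simp only [hL, map_zero]
  have hb := sum_along_along_eq (smooth_slice hF t)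
    ((EuclideanSpace.basisFun (Fin 3) ℝ).map Q) (EuclideanSpace.basisFun (Fin 3) ℝ) (Q z)
  simp only [along_along_slice hF, OrthonormalBasis.map_apply,
    EuclideanSpace.basisFun_apply] at hb
  rw [hb]
  exact hFw (t, Q z)

/-- Solutions with radial initial velocity and zero initial position are radial. -/
theorem SolvesWave.radial {f : ℝ → ℝ} (hf : ContDiff ℝ (⊤ : ℕ∞) f) {F : ℝ × R3 → ℝ}
    (hF : ContDiff ℝ (⊤ : ℕ∞) F) (hFw : SolvesWave f F) (h0 : ∀ z, F (0, z) = 0)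
    (h1 : Radial fun z => along (1, 0) F (0, z)) {t : ℝ} (ht : 0 ≤ t) :
    Radial fun z => F (t, z) := by
  intro z w hzw
  let Q : R3 ≃ₗᵢ[ℝ] R3 := (Submodule.span ℝ {z - w})ᗮ.reflection
  have hQ : Q z = w := Submodule.reflection_sub hzw
  let L : ℝ × R3 →L[ℝ] ℝ × R3 :=
    (ContinuousLinearMap.id ℝ ℝ).prodMap (Q.toContinuousLinearEquiv : R3 →L[ℝ] R3)
  have hFL : ContDiff ℝ (⊤ : ℕ∞) (fun p => F (L p)) := hF.comp L.contDiff
  have key := hFw.eq_of_eq_on_ball hf hF hFL (hFw.comp_isometry hF Q) (T := t + ‖z‖ + 1) (z₀ := 0)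
    (fun y _ => (h0 y).trans (h0 (Q y)).symm)
    (fun y _ => by
      rw [along_comp_clm hF]
      have hL1 : L (1, 0) = (1, 0) := by simp [L]
      rw [hL1]
      exact h1 y (Q y) (Q.norm_map y).symm) ht (z := z) (by rw [sub_zero]; linarith)
  exact key.trans (congrArg (fun y => F (t, y)) hQ)

/-- Finite speed of propagation for the nonlinear equation. -/
theorem SolvesWave.eq_zero_outside {f : ℝ → ℝ} (hf : ContDiff ℝ (⊤ : ℕ∞) f) (hf0 : f 0 = 0)
    {F : ℝ × R3 → ℝ} (hF : ContDiff ℝ (⊤ : ℕ∞) F) (hFw : SolvesWave f F)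
    (h0 : ∀ z, F (0, z) = 0) {ρ : ℝ} (h1 : ∀ z, ρ < ‖z‖ → along (1, 0) F (0, z) = 0)
    {t : ℝ} {z : R3} (ht : 0 ≤ t) (hz : t + ρ < ‖z‖) : F (t, z) = 0 := by
  have hzero : ∀ v : ℝ × R3, along v (fun _ => (0 : ℝ)) = fun _ => 0 := fun v => by
    ext; simp [along]
  refine hFw.eq_of_eq_on_ball hf hF (G := fun _ => 0) contDiff_const (fun p => by simp [hzero, hf0])
    (T := ‖z‖ - ρ) (z₀ := z) (fun y _ => h0 y) (fun y hy => ?_) ht (by simp; linarith)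
  rw [hzero]
  refine h1 y ?_
  have := norm_sub_norm_le z y
  rw [norm_sub_rev] at this
  linarith

/-- Derivatives of radial functions in tangential directions vanish. -/
theorem Radial.along_eq_zero {g : R3 → ℝ} (hg : ContDiff ℝ (⊤ : ℕ∞) g) (hr : Radial g)
    {y w : R3} (hyw : inner ℝ w y = 0) : along w g y = 0 := by
  let Q : R3 ≃ₗᵢ[ℝ] R3 := (Submodule.span ℝ {w})ᗮ.reflection
  have hQy : Q y = y := Submodule.reflection_mem_subspace_eq_self
    (Submodule.mem_orthogonal_singleton_iff_inner_right.2 hyw)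
  have hQw : Q w = -w := Submodule.reflection_orthogonalComplement_singleton_eq_neg w
  have hinv : (fun x => g ((Q.toContinuousLinearEquiv : R3 →L[ℝ] R3) x)) = g := by
    ext x
    exact hr _ _ (Q.norm_map x)
  have h1 := along_comp_clm hg (Q.toContinuousLinearEquiv : R3 →L[ℝ] R3) w y
  rw [hinv] at h1
  change along w g y = along (Q w) g (Q y) at h1
  rw [hQy, hQw] at h1
  have h2 : along (-w) g y = -along w g y := map_neg _ _
  linarith

/-- The Laplacian of a radial function in polar coordinates. -/
theorem Radial.mul_laplacian {g : R3 → ℝ} (hg : ContDiff ℝ (⊤ : ℕ∞) g) (hr : Radial g) (r : ℝ) :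
    r * ∑ i : Fin 3, along (EuclideanSpace.single i 1)
      (along (EuclideanSpace.single i 1) g) (r • EuclideanSpace.single 0 1) =
    r * along (EuclideanSpace.single 0 1) (along (EuclideanSpace.single 0 1) g)
      (r • EuclideanSpace.single 0 1) +
    2 * along (EuclideanSpace.single 0 1) g (r • EuclideanSpace.single 0 1) := by
  have key : ∀ i : Fin 3, i ≠ 0 → r * along (EuclideanSpace.single i 1)
      (along (EuclideanSpace.single i 1) g) (r • EuclideanSpace.single 0 1) =
      along (EuclideanSpace.single 0 1) g (r • EuclideanSpace.single 0 1) := by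
    intro i hi
    have hcoord : ∀ j : Fin 3, ContDiff ℝ (⊤ : ℕ∞) (fun y : R3 => y j) := fun j => by fun_prop
    have hdcoord : ∀ (j : Fin 3) (v p : R3), along v (fun y : R3 => y j) p = v j :=
      fun j v p => by
        have : HasFDerivAt (fun y : R3 => y j) (EuclideanSpace.proj j : R3 →L[ℝ] ℝ) p :=
          (EuclideanSpace.proj j : R3 →L[ℝ] ℝ).hasFDerivAt
        simp [along, this.fderiv]
    have hΩ : (fun y : R3 => y 0 * along (EuclideanSpace.single i 1) g y -
        y i * along (EuclideanSpace.single 0 1) g y) = fun _ => 0 := by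
      ext y
      have hperp : inner ℝ (y 0 • EuclideanSpace.single i (1 : ℝ) +
          (-y i) • EuclideanSpace.single (0 : Fin 3) (1 : ℝ)) y = 0 := by
        rw [inner_add_left, inner_smul_left, inner_smul_left, EuclideanSpace.inner_single_left,
          EuclideanSpace.inner_single_left]
        simp
        ring
      have := hr.along_eq_zero hg hperp
      rw [along_add_dir, along_smul_dir, along_smul_dir] at this
      linarith
    have h1 := along_sub ((hcoord 0).mul (contDiff_along hg (EuclideanSpace.single i 1)))
      ((hcoord i).mul (contDiff_along hg (EuclideanSpace.single 0 1)))
      (EuclideanSpace.single i 1) (r • EuclideanSpace.single 0 1)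
    rw [hΩ, along_mul (hcoord 0) (contDiff_along hg _), along_mul (hcoord i) (contDiff_along hg _),
      hdcoord, hdcoord] at h1
    simp [hi, hi.symm, along] at h1
    simp only [along]
    linarith
  rw [Fin.sum_univ_three, mul_add, mul_add, key 1 (by decide), key 2 (by decide)]
  ring

/-- The map from null coordinates to the radial half-plane in space-time. -/
def nullMap : ℝ × ℝ →L[ℝ] ℝ × R3 :=
  ((1 / 2 : ℝ) • (ContinuousLinearMap.fst ℝ ℝ ℝ + ContinuousLinearMap.snd ℝ ℝ ℝ)).prod
    (((1 / 2 : ℝ) • (ContinuousLinearMap.snd ℝ ℝ ℝ - ContinuousLinearMap.fst ℝ ℝ ℝ)).smulRight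
      (EuclideanSpace.single 0 1))

theorem nullMap_apply (p : ℝ × ℝ) :
    nullMap p = ((p.1 + p.2) / 2, ((p.2 - p.1) / 2) • EuclideanSpace.single 0 1) := by
  simp [nullMap, div_eq_inv_mul, mul_add]

/-- The radial profile `r u(t, r)` in null coordinates `(t - r, t + r)`. -/
def nullProfile (F : ℝ × R3 → ℝ) (p : ℝ × ℝ) : ℝ :=
  (p.2 - p.1) / 2 * F (nullMap p)

section NullProfile

variable {F : ℝ × R3 → ℝ}

theorem smooth_nullProfile (hF : ContDiff ℝ (⊤ : ℕ∞) F) :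
    ContDiff ℝ (⊤ : ℕ∞) (nullProfile F) :=
  ((contDiff_snd.sub contDiff_fst).div_const 2).mul (hF.comp nullMap.contDiff)

theorem along_nullProfile (hF : ContDiff ℝ (⊤ : ℕ∞) F) (v p : ℝ × ℝ) :
    along v (nullProfile F) p = (v.2 - v.1) / 2 * F (nullMap p) +
      (p.2 - p.1) / 2 * along (nullMap v) F (nullMap p) := by
  have hlin : along v (fun q : ℝ × ℝ => (q.2 - q.1) / 2) p = (v.2 - v.1) / 2 := by
    have : HasFDerivAt (fun q : ℝ × ℝ => ((1 / 2 : ℝ) • (ContinuousLinearMap.snd ℝ ℝ ℝ -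
        ContinuousLinearMap.fst ℝ ℝ ℝ)) q) _ p := ContinuousLinearMap.hasFDerivAt _
    have h' : (fun q : ℝ × ℝ => (q.2 - q.1) / 2) = fun q : ℝ × ℝ =>
        ((1 / 2 : ℝ) • (ContinuousLinearMap.snd ℝ ℝ ℝ - ContinuousLinearMap.fst ℝ ℝ ℝ)) q := by
      ext q
      simp [div_eq_inv_mul]
    rw [h', along, this.fderiv]
    simp [div_eq_inv_mul]
  have := along_mul (F := fun q : ℝ × ℝ => (q.2 - q.1) / 2)
    ((contDiff_snd.sub contDiff_fst).div_const 2) (hF.comp nullMap.contDiff) v p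
  change along v (nullProfile F) p = _ at this
  rw [this, hlin]
  congr 2
  exact along_comp_clm hF nullMap v p

theorem along_along_nullProfile (hF : ContDiff ℝ (⊤ : ℕ∞) F) (v w p : ℝ × ℝ) :
    along v (along w (nullProfile F)) p =
      (w.2 - w.1) / 2 * along (nullMap v) F (nullMap p) +
      ((v.2 - v.1) / 2 * along (nullMap w) F (nullMap p) +
        (p.2 - p.1) / 2 * along (nullMap v) (along (nullMap w) F) (nullMap p)) := by
  have hw := contDiff_along hF (nullMap w)
  have heq : along w (nullProfile F) = fun q => (w.2 - w.1) / 2 * F (nullMap q) +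
      nullProfile (along (nullMap w) F) q := funext (along_nullProfile hF w)
  have hc : ContDiff ℝ (⊤ : ℕ∞) (fun _ : ℝ × ℝ => (w.2 - w.1) / 2) := contDiff_const
  have hFn : ContDiff ℝ (⊤ : ℕ∞) (fun q => F (nullMap q)) := hF.comp nullMap.contDiff
  have hzero : along v (fun _ : ℝ × ℝ => (w.2 - w.1) / 2) p = 0 := by simp [along]
  rw [heq, along_add (hc.mul hFn) (smooth_nullProfile hw), along_nullProfile hw, along_mul hc hFn,
    hzero, along_comp_clm hF]
  ring

/-- For radial solutions the wave equation becomes one-dimensional. -/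
theorem along_along_nullProfile_of_radial {f : ℝ → ℝ} (hF : ContDiff ℝ (⊤ : ℕ∞) F)
    (hFw : SolvesWave f F) {x y : ℝ} (hr : Radial fun z => F ((x + y) / 2, z)) :
    along (0, 1) (along (1, 0) (nullProfile F)) (x, y) =
      -((y - x) / 2 * f (F (nullMap (x, y)))) / 4 := by
  have h1 := contDiff_along hF
  set e : R3 := EuclideanSpace.single 0 1 with he
  have hv1 : nullMap (0, 1) = (1 / 2 : ℝ) • ((1 : ℝ), (0 : R3)) + (1 / 2 : ℝ) • ((0 : ℝ), e) := by
    rw [nullMap_apply]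
    ext <;> simp [he]
  have hv2 : nullMap (1, 0) = (1 / 2 : ℝ) • ((1 : ℝ), (0 : R3)) + (-1 / 2 : ℝ) • ((0 : ℝ), e) := by
    rw [nullMap_apply]
    ext <;> simp [he]
  have hfun : along ((1 / 2 : ℝ) • ((1 : ℝ), (0 : R3)) + (-1 / 2 : ℝ) • ((0 : ℝ), e)) F =
      fun q => (1 / 2) * along (1, 0) F q + (-1 / 2) * along (0, e) F q := by
    ext q
    rw [along_add_dir, along_smul_dir, along_smul_dir]
  have hmul : ∀ (a : ℝ) (v w q : ℝ × R3),
      along v (fun q => a * along w F q) q = a * along v (along w F) q := fun a v w q => by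
    rw [along_mul contDiff_const (h1 w)]
    simp [along]
  have hpt : nullMap (x, y) = ((x + y) / 2, ((y - x) / 2) • e) := nullMap_apply _
  rw [along_along_nullProfile hF, hv1, hv2, hfun]
  have hadd := fun v => along_add (contDiff_const.mul (h1 (1, 0)))
    (contDiff_const.mul (h1 (0, e))) (F := fun q => (1 / 2) * along (1, 0) F q)
    (G := fun q => (-1 / 2) * along (0, e) F q) v (nullMap (x, y))
  simp only [along_add_dir, along_smul_dir, hadd, hmul]
  rw [along_comm hF (0, e) (1, 0)]
  have hlap := hr.mul_laplacian (smooth_slice hF _) ((y - x) / 2)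
  simp only [along_along_slice hF, along_slice hF, ← he, ← hpt] at hlap
  have hw := hFw (nullMap (x, y))
  have hw' := congrArg (fun s => (y - x) / 2 * s) hw
  simp only [mul_add, mul_sub, hlap] at hw'
  linarith

/-- The radial profile of a solution satisfies the hypotheses of unique continuation from null
infinity. -/
theorem nullWave_nullProfile {f : ℝ → ℝ} (hF : ContDiff ℝ (⊤ : ℕ∞) F) (hFw : SolvesWave f F)
    (hr : ∀ t, 0 ≤ t → Radial fun z => F (t, z)) (h0 : ∀ z, F (0, z) = 0) {R c : ℝ}
    (hR : 0 < R) (hc : 0 ≤ c) (hf : ∀ v, |f v| ≤ c * |v| ^ 5) :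
    NullWave (fun x y => nullProfile F (x, y)) (fun x y => along (1, 0) (nullProfile F) (x, y))
      (fun x y => along (0, 1) (nullProfile F) (x, y))
      (fun x y => along (0, 1) (along (1, 0) (nullProfile F)) (x, y)) R (c / R ^ 2) := by
  have hG := smooth_nullProfile hF
  have hleft : ∀ {G : ℝ × ℝ → ℝ}, ContDiff ℝ (⊤ : ℕ∞) G → ∀ x y,
      HasDerivAt (fun s => G (s, y)) (along (1, 0) G (x, y)) x := fun hG x y =>
    (differentiable_of_smooth hG (x, y)).hasFDerivAt.comp_hasDerivAt x
      ((hasDerivAt_id x).prodMk (hasDerivAt_const x y))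
  have hright : ∀ {G : ℝ × ℝ → ℝ}, ContDiff ℝ (⊤ : ℕ∞) G → ∀ x y,
      HasDerivAt (fun s => G (x, s)) (along (0, 1) G (x, y)) y := fun hG x y =>
    (differentiable_of_smooth hG (x, y)).hasFDerivAt.comp_hasDerivAt y
      ((hasDerivAt_const y x).prodMk (hasDerivAt_id y))
  refine ⟨hleft hG, hright hG, hright (contDiff_along hG _), ?_, hG.continuous, ?_, ?_⟩
  · intro x y
    simp only [along_comm hG (0, 1) (1, 0)]
    exact hleft (contDiff_along hG _) x y
  · intro x y hx hy h1
    rw [along_along_nullProfile_of_radial hF hFw (hr _ (by linarith))]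
    simp only [nullProfile] at h1 ⊢
    set v := F (nullMap (x, y))
    set ρ := (y - x) / 2 with hρ
    have hρR : R ≤ ρ := by linarith
    have hρy : y + R ≤ 2 * ρ := by linarith
    have hρ0 : 0 < ρ := by linarith
    have hyR : 0 < y + R := by linarith
    rw [abs_mul, abs_of_pos hρ0] at h1 ⊢
    have h2 : |v| ^ 4 * (R ^ 2 * (y + R) ^ 2) ≤ 4 := by
      have h3 : R ^ 2 * (y + R) ^ 2 ≤ ρ ^ 2 * (2 * ρ) ^ 2 := by gcongr
      calc |v| ^ 4 * (R ^ 2 * (y + R) ^ 2) ≤ |v| ^ 4 * (ρ ^ 2 * (2 * ρ) ^ 2) := by gcongr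
        _ = 4 * (ρ * |v|) ^ 4 := by ring
        _ ≤ 4 * 1 ^ 4 := by gcongr
        _ = 4 := by norm_num
    have h4 : |v| ^ 4 ≤ 4 / (R ^ 2 * (y + R) ^ 2) := by
      rw [le_div_iff₀ (by positivity)]
      exact h2
    rw [abs_div, abs_neg, abs_mul, abs_of_pos hρ0, abs_of_pos (by norm_num : (0 : ℝ) < 4)]
    calc ρ * |f v| / 4 ≤ ρ * (c * |v| ^ 5) / 4 := by gcongr; exact hf v
      _ = c / 4 * |v| ^ 4 * (ρ * |v|) := by ring
      _ ≤ c / 4 * (4 / (R ^ 2 * (y + R) ^ 2)) * (ρ * |v|) := by gcongr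
      _ = c / R ^ 2 / (y + R) ^ 2 * (ρ * |v|) := by field_simp
  · intro x
    simp [nullProfile, nullMap_apply, h0]

end NullProfile

/-- Support theorem for the forward radiation field of the semilinear wave equation
with radial data (0, ψ): if the radiation field vanishes for s ≤ −R then ψ vanishes
for |z| ≥ R. -/
theorem radial_support_theorem
    (f : ℝ → ℝ) (hf : NiceF f) (R : ℝ) (hR : 0 < R)
    (ψ : R3 → ℝ) (hψs : ContDiff ℝ (⊤ : ℕ∞) ψ) (hψc : HasCompactSupport ψ) (hψr : Radial ψ)
    (u : ℝ → R3 → ℝ) (hu : ContDiff ℝ (⊤ : ℕ∞) (fun p : ℝ × R3 => u p.1 p.2))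
    (hwave : ∀ t z, dt2 u t z - lap (u t) z + f (u t z) = 0)
    (hu0 : ∀ z, u 0 z = 0) (hu1 : ∀ z, dt u 0 z = ψ z)
    (hrad : ∀ s : ℝ, s ≤ -R → ∀ θ : R3, ‖θ‖ = 1 →
      Tendsto (fun r : ℝ => r * dt u (s + r) (r • θ)) atTop (nhds 0)) :
    ∀ z : R3, R ≤ ‖z‖ → ψ z = 0 := by
  obtain ⟨⟨f₀, hf₀s, hf₀, -⟩, -, ⟨c₁, c, -, hc, hfb⟩, -⟩ := hf
  have hfs : ContDiff ℝ (⊤ : ℕ∞) f := by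
    rw [funext hf₀]
    exact contDiff_id.mul (hf₀s.comp (contDiff_id.pow 2))
  have hf0 : f 0 = 0 := by simp [hf₀]
  set F : ℝ × R3 → ℝ := fun p => u p.1 p.2 with hFdef
  have hdt : ∀ t z, dt u t z = along (1, 0) F (t, z) := fun t z => (hasDerivAt_slice hu t z).deriv
  have hFw : SolvesWave f F := by
    rintro ⟨t, z⟩
    have h1 : dt2 u t z = along (1, 0) (along (1, 0) F) (t, z) := by
      simp only [dt2, hdt]
      exact (hasDerivAt_slice (contDiff_along hu _) t z).deriv
    have h2 : lap (u t) z = ∑ i : Fin 3, along (0, EuclideanSpace.single i 1)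
        (along (0, EuclideanSpace.single i 1) F) (t, z) := by
      simp only [← along_along_slice hu]
      rfl
    have := hwave t z
    rwa [h1, h2] at this
  have h1 : ∀ z, along (1, 0) F (0, z) = ψ z := fun z => by rw [← hdt, hu1]
  have hr : ∀ t, 0 ≤ t → Radial fun z => F (t, z) := fun t ht =>
    hFw.radial hfs hu hu0 (by simpa only [h1] using hψr) ht
  have hnull := nullWave_nullProfile hu hFw hr hu0 hR hc.le fun v => (hfb v).2
  obtain ⟨ρ, hρ⟩ := hψc.isBounded.subset_closedBall (0 : R3)
  have hfar : ∀ z, ρ < ‖z‖ → along (1, 0) F (0, z) = 0 := fun z hz => by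
    rw [h1]
    refine image_eq_zero_of_notMem_tsupport fun hmem => ?_
    have := hρ hmem
    rw [mem_closedBall, dist_zero_right] at this
    linarith
  set e : R3 := EuclideanSpace.single 0 1
  have he : ‖e‖ = 1 := by simp [e]
  have hsum : ∀ x y, along (1, 0) (nullProfile F) (x, y) + along (0, 1) (nullProfile F) (x, y) =
      (y - x) / 2 * along (1, 0) F ((x + y) / 2, ((y - x) / 2) • e) := fun x y => by
    rw [← along_add_dir, along_nullProfile hu, nullMap_apply, nullMap_apply]
    simp [e]
  have hzero : ∀ x y, x ≤ -R → -x ≤ y → nullProfile F (x, y) = 0 := by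
    intro x y hx hy
    refine hnull.eq_zero hR (by positivity) ?_ (R₀ := ρ + 1) ?_ ?_ hx hy
    · exact (contDiff_along (smooth_nullProfile hu) _).continuous.comp (by fun_prop)
    · intro x y hx hy
      rw [nullProfile, nullMap_apply]
      refine mul_eq_zero_of_right _
        (hFw.eq_zero_outside hfs hf0 hu hu0 hfar (by simp only; linarith) ?_)
      rw [norm_smul, he, mul_one]
      refine lt_of_lt_of_le ?_ (le_abs_self _)
      simp only
      linarith
    · intro x hx
      have hlim : Tendsto (fun y : ℝ => (y - x) / 2) atTop atTop :=
        (tendsto_atTop_add_const_right _ (-x) tendsto_id).atTop_div_const two_pos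
      refine ((hrad x hx e he).comp hlim).congr fun y => ?_
      simp only [Function.comp, hsum, hdt]
      congr 3
      ring
  have hB : ∀ r, R ≤ r → along (0, 1) (nullProfile F) (-r, r) = 0 := by
    intro r hr
    have hd := (hnull.right (-r) r).hasDerivWithinAt (s := Set.Ici r)
    have hd0 : HasDerivWithinAt (fun y => nullProfile F (-r, y)) 0 (Set.Ici r) r :=
      (hasDerivWithinAt_const r _ (0 : ℝ)).congr
        (fun y hy => hzero _ _ (by linarith) (by simpa using hy))
        (hzero _ _ (by linarith) (by simp))
    exact (uniqueDiffOn_Ici r r Set.self_mem_Ici).eq_deriv _ hd hd0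
  have hAB : ∀ r, along (1, 0) (nullProfile F) (-r, r) = along (0, 1) (nullProfile F) (-r, r) := by
    intro r
    have hd : HasDerivAt (fun s : ℝ => nullProfile F (-s, s))
        (along (-1, 1) (nullProfile F) (-r, r)) r :=
      (differentiable_of_smooth (smooth_nullProfile hu) (-r, r)).hasFDerivAt.comp_hasDerivAt
        (f := fun s : ℝ => (-s, s)) r ((hasDerivAt_neg r).prodMk (hasDerivAt_id r))
    have hd0 : (fun s : ℝ => nullProfile F (-s, s)) = fun _ => 0 := by
      ext s
      simpa using hnull.init (-s)
    rw [hd0] at hd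
    have h2 := hd.unique (hasDerivAt_const r 0)
    rw [show ((-1 : ℝ), (1 : ℝ)) = (-1 : ℝ) • (1, 0) + (0, 1) by ext <;> simp, along_add_dir,
      along_smul_dir] at h2
    linarith
  intro z hz
  have hz0 : ‖z‖ ≠ 0 := by linarith
  have h3 := hsum (-‖z‖) ‖z‖
  rw [hAB, hB _ hz, add_zero] at h3
  have h4 : along (1, 0) F (0, ‖z‖ • e) = 0 := by
    have h5 : (‖z‖ - -‖z‖) / 2 = ‖z‖ := by ring
    rw [h5, neg_add_cancel, zero_div] at h3
    exact (mul_eq_zero.1 h3.symm).resolve_left hz0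
  rw [h1] at h4
  rw [hψr z (‖z‖ • e) (by rw [norm_smul, he, mul_one, norm_norm]), h4]
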